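/- Let F_n denote the Fibonacci numbers, L_n the Lucas numbers, and φ := (1+√5)/2. Then for every odd positive integer k, ∑_{n=1}^{∞} L( L_k² / (5·F_{2kn}²) ) + ∑_{n=1}^{∞} L( L_k² / L_{k(2n+1)}² ) = L( 1/φ^{2k} ). -/

import Mathlib

/-- The Rogers dilogarithm on `[0,1]`: `L(x) = Li₂(x) + (1/2)·log x · log (1-x)`
for `0 < x < 1`, with `L 0 = 0` and `L 1 = π²/6`. -/
noncomputable def rogersL (x : ℝ) : ℝ :=
  if x = 0 then 0
  else if x = 1 then Real.pi ^ 2 / 6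
  else (∑' n : ℕ, x ^ (n + 1) / ((n : ℝ) + 1) ^ 2) + 1 / 2 * Real.log x * Real.log (1 - x)

/-- The Lucas numbers: `L 0 = 2`, `L 1 = 1`, `L (n+2) = L (n+1) + L n`. -/
def lucasNum : ℕ → ℕ
  | 0 => 2
  | 1 => 1
  | n + 2 => lucasNum (n + 1) + lucasNum n

open Filter Topology Set

/-- The series `∑ xⁿ / n²` of the dilogarithm. -/
noncomputable def dilogSeries (x : ℝ) : ℝ := ∑' n : ℕ, x ^ (n + 1) / ((n : ℝ) + 1) ^ 2

lemma hasDerivAt_dilogSeries {x : ℝ} (hx : |x| < 1) :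
    HasDerivAt dilogSeries (∑' n : ℕ, x ^ n / ((n : ℝ) + 1)) x := by
  obtain ⟨r, hxr, hr⟩ := exists_between hx
  have hr0 : 0 < r := (abs_nonneg x).trans_lt hxr
  refine hasDerivAt_tsum_of_isPreconnected (u := fun n : ℕ => r ^ n) (t := Ioo (-r) r)
    (g := fun (n : ℕ) (y : ℝ) => y ^ (n + 1) / ((n : ℝ) + 1) ^ 2)
    (g' := fun (n : ℕ) (y : ℝ) => y ^ n / ((n : ℝ) + 1)) (y₀ := 0)
    (summable_geometric_of_lt_one hr0.le hr) isOpen_Ioo isPreconnected_Ioo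
    ?_ ?_ (by simp [hr0]) (by simp) (abs_lt.mp hxr)
  · intro n y _
    have h := (hasDerivAt_pow (n + 1) y).div_const (((n : ℝ) + 1) ^ 2)
    refine h.congr_deriv ?_
    have : (n : ℝ) + 1 ≠ 0 := by positivity
    push_cast
    field_simp
  · intro n y hy
    have hy' : |y| ≤ r := (abs_lt.mpr hy).le
    rw [Real.norm_eq_abs, abs_div, abs_pow, abs_of_pos (by positivity : (0 : ℝ) < (n : ℝ) + 1)]
    calc |y| ^ n / ((n : ℝ) + 1) ≤ |y| ^ n := div_le_self (by positivity) (by simp)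
      _ ≤ r ^ n := by gcongr

lemma rogersL_eq {x : ℝ} (hx : x ∈ Ico (0 : ℝ) 1) :
    rogersL x = dilogSeries x + 1 / 2 * Real.log x * Real.log (1 - x) := by
  unfold rogersL dilogSeries
  split_ifs with h0 h1
  · simp [h0]
  · exact absurd h1 hx.2.ne
  · rfl

lemma continuousOn_rogersL : ContinuousOn rogersL (Ico 0 1) := by
  have hd : ∀ x ∈ Ico (0 : ℝ) 1, DifferentiableAt ℝ (fun y : ℝ => Real.log (1 - y)) x := by
    intro x hx
    have : 1 - x ≠ 0 := by linarith [hx.2]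
    fun_prop (disch := assumption)
  have hL : ContinuousOn (fun x => dilogSeries x +
      1 / 2 * (x * Real.log x) * dslope (fun y : ℝ => Real.log (1 - y)) 0 x) (Ico 0 1) := by
    refine ContinuousOn.add ?_ (ContinuousOn.mul ?_ ?_)
    · intro x hx
      exact (hasDerivAt_dilogSeries (abs_lt.mpr
        ⟨by linarith [hx.1], hx.2⟩)).continuousAt.continuousWithinAt
    · exact (continuous_const.mul Real.continuous_mul_log).continuousOn
    · intro x hx
      refine ContinuousAt.continuousWithinAt ?_
      rcases eq_or_ne x 0 with rfl | h
      · exact continuousAt_dslope_same.mpr (hd _ hx)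
      · exact (continuousAt_dslope_of_ne h).mpr (hd _ hx).continuousAt
  refine hL.congr fun x hx => ?_
  have h := sub_smul_dslope (fun y : ℝ => Real.log (1 - y)) 0 x
  simp only [sub_zero, Real.log_one, smul_eq_mul] at h
  rw [rogersL_eq hx, ← h]
  ring

lemma continuousAt_rogersL {x : ℝ} (hx : x ∈ Ioo (0 : ℝ) 1) : ContinuousAt rogersL x :=
  continuousOn_rogersL.continuousAt (Ico_mem_nhds hx.1 hx.2)

lemma hasDerivAt_rogersL {x : ℝ} (hx : x ∈ Ioo (0 : ℝ) 1) :
    HasDerivAt rogersL (-(1 / 2) * (Real.log (1 - x) / x + Real.log x / (1 - x))) x := by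
  obtain ⟨h0, h1⟩ := hx
  have hx1 : 1 - x ≠ 0 := by linarith
  have habs : |x| < 1 := abs_lt.mpr ⟨by linarith, h1⟩
  have hs : (∑' n : ℕ, x ^ n / ((n : ℝ) + 1)) = -Real.log (1 - x) / x := by
    refine HasSum.tsum_eq ?_
    refine ((Real.hasSum_pow_div_log_of_abs_lt_one habs).div_const x).congr_fun ?_
    intro n
    field_simp
    ring
  have hl := ((Real.hasDerivAt_log h0.ne').const_mul (1 / 2)).mul
    (((hasDerivAt_id x).const_sub 1).log hx1)
  have h := (hasDerivAt_dilogSeries habs).add hl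
  rw [hs] at h
  refine (h.congr_of_eventuallyEq ?_).congr_deriv ?_
  · filter_upwards [Ioo_mem_nhds h0 h1] with y hy
    simpa using rogersL_eq ⟨hy.1.le, hy.2⟩
  · simp only [id]
    field_simp
    ring

/-- The chain rule for `rogersL`, in terms of the logarithmic derivatives `p` of `u` and
`q` of `1 - u`. -/
lemma HasDerivAt.rogersL_comp {u : ℝ → ℝ} {u' x p q : ℝ} (hu : HasDerivAt u u' x)
    (hx : u x ∈ Ioo (0 : ℝ) 1) (hp : u' = u x * p) (hq : u' = -((1 - u x) * q)) :
    HasDerivAt (fun y => rogersL (u y))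
      (-(1 / 2) * (p * Real.log (1 - u x) - q * Real.log (u x))) x := by
  refine ((hasDerivAt_rogersL hx).comp x hu).congr_deriv ?_
  have h0 : u x ≠ 0 := hx.1.ne'
  have h1 : 1 - u x ≠ 0 := by linarith [hx.2]
  have hp' : p = u' / u x := by rw [hp]; field_simp
  have hq' : q = -(u' / (1 - u x)) := by rw [hq]; field_simp
  rw [hp', hq']
  ring

lemma rogersL_add_rogersL_one_sub {x y : ℝ} (hx : x ∈ Ioo (0 : ℝ) 1) (hy : y ∈ Ioo (0 : ℝ) 1) :
    rogersL x + rogersL (1 - x) = rogersL y + rogersL (1 - y) := by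
  have hd : ∀ z ∈ Ioo (0 : ℝ) 1, HasDerivAt (fun z => rogersL z + rogersL (1 - z)) 0 z := by
    intro z hz
    have hz' : 1 - z ∈ Ioo (0 : ℝ) 1 := ⟨by linarith [hz.2], by linarith [hz.1]⟩
    have h := (hasDerivAt_rogersL hz).add
      ((hasDerivAt_rogersL hz').comp z ((hasDerivAt_id z).const_sub 1))
    refine h.congr_deriv ?_
    rw [sub_sub_cancel]
    ring
  exact isOpen_Ioo.is_const_of_deriv_eq_zero isPreconnected_Ioo
    (fun z hz => (hd z hz).differentiableAt.differentiableWithinAt)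
    (fun z hz => (hd z hz).deriv) hx hy

lemma one_sub_mul_pos {x y : ℝ} (hx : x ∈ Ico (0 : ℝ) 1) (hy : y ∈ Ioo (0 : ℝ) 1) :
    0 < 1 - x * y := by
  nlinarith [hx.1, hx.2, hy.1, hy.2]

/-- Abel's five-term relation. -/
lemma rogersL_five_term {x y : ℝ} (hx : x ∈ Ioo (0 : ℝ) 1) (hy : y ∈ Ioo (0 : ℝ) 1) :
    rogersL x + rogersL y = rogersL (x * y) + rogersL (x * (1 - y) / (1 - x * y)) +
      rogersL (y * (1 - x) / (1 - x * y)) := by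
  have hy0 := hy.1
  have hy1 : 0 < 1 - y := by linarith [hy.2]
  set f : ℝ → ℝ := fun z => rogersL z - rogersL (z * y) - rogersL (z * (1 - y) / (1 - z * y)) -
      rogersL (y * (1 - z) / (1 - z * y)) with hf
  have hmul : ∀ z ∈ Ico (0 : ℝ) 1, z * y ∈ Ico (0 : ℝ) 1 := fun z hz =>
    ⟨mul_nonneg hz.1 hy0.le, by linarith [one_sub_mul_pos hz hy]⟩
  have hu : ∀ z ∈ Ico (0 : ℝ) 1, z * (1 - y) / (1 - z * y) ∈ Ico (0 : ℝ) 1 := by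
    intro z hz
    have := one_sub_mul_pos hz hy
    refine ⟨div_nonneg (mul_nonneg hz.1 hy1.le) this.le, ?_⟩
    rw [div_lt_one this]
    linarith [hz.2]
  have hv : ∀ z ∈ Ico (0 : ℝ) 1, y * (1 - z) / (1 - z * y) ∈ Ico (0 : ℝ) 1 := by
    intro z hz
    have := one_sub_mul_pos hz hy
    refine ⟨div_nonneg (mul_nonneg hy0.le (by linarith [hz.2])) this.le, ?_⟩
    rw [div_lt_one this]
    linarith [hy.2]
  have hcont : ContinuousOn f (Ico 0 1) := by
    have hne : ∀ z ∈ Ico (0 : ℝ) 1, 1 - z * y ≠ 0 := fun z hz => (one_sub_mul_pos hz hy).ne'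
    refine ((continuousOn_rogersL.sub (continuousOn_rogersL.comp ?_ hmul)).sub
      (continuousOn_rogersL.comp ?_ hu)).sub (continuousOn_rogersL.comp ?_ hv)
    · fun_prop
    · fun_prop (disch := assumption)
    · fun_prop (disch := assumption)
  have hderiv : ∀ z ∈ Ioo (0 : ℝ) 1, HasDerivAt f 0 z := by
    intro z hz
    have hz0 := hz.1
    have hz1 : 0 < 1 - z := by linarith [hz.2]
    have hzI : z ∈ Ico (0 : ℝ) 1 := ⟨hz.1.le, hz.2⟩
    have hw := one_sub_mul_pos hzI hy
    have hw' : 1 - y * z ≠ 0 := by rw [mul_comm]; exact hw.ne'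
    have hwd : HasDerivAt (fun z : ℝ => 1 - z * y) (-(1 * y)) z :=
      ((hasDerivAt_id z).mul_const y).const_sub 1
    have e1 : 1 - z * (1 - y) / (1 - z * y) = (1 - z) / (1 - z * y) := by
      rw [eq_div_iff hw.ne', sub_mul, div_mul_cancel₀ _ hw.ne']; ring
    have e2 : 1 - y * (1 - z) / (1 - z * y) = (1 - y) / (1 - z * y) := by
      rw [eq_div_iff hw.ne', sub_mul, div_mul_cancel₀ _ hw.ne']; ring
    have d0 := (hasDerivAt_id z).rogersL_comp (p := 1 / z) (q := -1 / (1 - z)) hz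
      (by simp; field_simp) (by simp; field_simp)
    have d1 := ((hasDerivAt_id z).mul_const y).rogersL_comp (p := 1 / z)
      (q := -y / (1 - z * y)) ⟨mul_pos hz0 hy0, by simp only [id]; linarith⟩
      (by simp only [id]; field_simp) (by simp only [id]; field_simp)
    have d2 := (((hasDerivAt_id z).mul_const (1 - y)).div hwd hw.ne').rogersL_comp
      (p := 1 / z + y / (1 - z * y)) (q := -1 / (1 - z) + y / (1 - z * y))
      ⟨div_pos (mul_pos hz0 hy1) hw, (hu z hzI).2⟩
      (by simp; field_simp)
      (by simp only [id, Pi.div_apply]; rw [e1]; field_simp; ring)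
    have d3 := ((((hasDerivAt_id z).const_sub 1).const_mul y).div hwd hw.ne').rogersL_comp
      (p := -1 / (1 - z) + y / (1 - z * y)) (q := y / (1 - z * y))
      ⟨div_pos (mul_pos hy0 hz1) hw, (hv z hzI).2⟩
      (by simp; field_simp)
      (by simp only [id, Pi.div_apply]; rw [e2]; field_simp; ring)
    refine (((d0.sub d1).sub d2).sub d3).congr_deriv ?_
    simp only [id, Pi.div_apply]
    rw [e1, e2, Real.log_div hz1.ne' hw.ne', Real.log_div hy1.ne' hw.ne',
      Real.log_div (mul_pos hz0 hy1).ne' hw.ne', Real.log_div (mul_pos hy0 hz1).ne' hw.ne',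
      Real.log_mul hz0.ne' hy1.ne', Real.log_mul hy0.ne' hz1.ne', Real.log_mul hz0.ne' hy0.ne']
    ring
  obtain ⟨c, hc, hslope⟩ := exists_hasDerivAt_eq_slope f (fun _ => 0) hx.1
    (hcont.mono (Icc_subset_Ico_right hx.2))
    (fun z hz => hderiv z ⟨hz.1, hz.2.trans hx.2⟩)
  have hfx : f x = f 0 := by
    have hxne : x - 0 ≠ 0 := by linarith [hx.1]
    have := (div_eq_zero_iff.mp hslope.symm).resolve_right hxne
    linarith
  have h0 : rogersL 0 = 0 := by simp [rogersL]
  simp only [hf, zero_mul, sub_zero, mul_one, div_one, h0] at hfx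
  linarith

lemma rogersL_nonneg {x : ℝ} (hx : x ∈ Ioo (0 : ℝ) 1) : 0 ≤ rogersL x := by
  obtain ⟨h0, h1⟩ := hx
  rw [rogersL_eq ⟨h0.le, h1⟩, mul_assoc]
  refine add_nonneg (tsum_nonneg fun n => by positivity) (mul_nonneg (by norm_num) ?_)
  exact mul_nonneg_of_nonpos_of_nonpos (Real.log_nonpos h0.le h1.le)
    (Real.log_nonpos (by linarith) (by linarith))

/-- The `q`-analogue of `∑ L(1/m²) = L(1)`. -/
lemma hasSum_rogersL_qNumber {q : ℝ} (hq : q ∈ Ioo (0 : ℝ) 1) :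
    HasSum (fun j : ℕ => rogersL (q ^ (j + 1) * (1 - q) ^ 2 / (1 - q ^ (j + 2)) ^ 2))
      (rogersL q) := by
  have hq0 := hq.1
  have hq1 : 0 < 1 - q := by linarith [hq.2]
  have hpow : ∀ j : ℕ, 0 < 1 - q ^ (j + 1) := fun j => by
    linarith [pow_lt_one₀ hq0.le hq.2 (Nat.add_one_ne_zero j)]
  set x : ℕ → ℝ := fun j => (1 - q) / (1 - q ^ (j + 2)) with hxdef
  set y : ℕ → ℝ := fun j => q ^ (j + 1) * (1 - q) / (1 - q ^ (j + 2)) with hydef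
  have hx : ∀ j, x j ∈ Ioo (0 : ℝ) 1 := by
    intro j
    refine ⟨div_pos hq1 (hpow _), ?_⟩
    rw [hxdef]
    simp only
    rw [div_lt_one (hpow _), pow_succ]
    nlinarith [hpow j]
  have hy : ∀ j, y j ∈ Ioo (0 : ℝ) 1 := by
    intro j
    refine ⟨div_pos (by positivity) (hpow _), ?_⟩
    rw [hydef]
    simp only
    rw [div_lt_one (hpow _), pow_succ _ (j + 1)]
    nlinarith [hpow j]
  have hxy : ∀ j, q ^ (j + 1) * (1 - q) ^ 2 / (1 - q ^ (j + 2)) ^ 2 = x j * y j := by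
    intro j
    have := (hpow (j + 1)).ne'
    simp only [hxdef, hydef]
    field_simp
  have hone : ∀ j, 1 - x j * y j =
      (1 - q ^ (j + 1)) * (1 - q ^ (j + 3)) / (1 - q ^ (j + 2)) ^ 2 := by
    intro j
    have := (hpow (j + 1)).ne'
    rw [← hxy, eq_div_iff (by positivity), sub_mul, div_mul_cancel₀ _ (by positivity)]
    ring
  have hx1 : ∀ j, 1 - x j = q * (1 - q ^ (j + 1)) / (1 - q ^ (j + 2)) := by
    intro j
    have := (hpow (j + 1)).ne'
    simp only [hxdef]
    rw [eq_div_iff this, sub_mul, div_mul_cancel₀ _ this]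
    ring
  have hy1 : ∀ j, 1 - y j = (1 - q ^ (j + 1)) / (1 - q ^ (j + 2)) := by
    intro j
    have := (hpow (j + 1)).ne'
    simp only [hydef]
    rw [eq_div_iff this, sub_mul, div_mul_cancel₀ _ this]
    ring
  have hu : ∀ j, x j * (1 - y j) / (1 - x j * y j) = x (j + 1) := by
    intro j
    have h1 := (hpow j).ne'
    have h2 := (hpow (j + 1)).ne'
    have h3 := (hpow (j + 2)).ne'
    rw [hone, hy1]
    simp only [hxdef, add_assoc, Nat.reduceAdd] at *
    field_simp
  have hv : ∀ j, y j * (1 - x j) / (1 - x j * y j) = y (j + 1) := by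
    intro j
    have h1 := (hpow j).ne'
    have h2 := (hpow (j + 1)).ne'
    have h3 := (hpow (j + 2)).ne'
    rw [hone, hx1]
    simp only [hydef, add_assoc, Nat.reduceAdd] at *
    field_simp
    ring
  set G : ℕ → ℝ := fun j => rogersL (x j) + rogersL (y j) with hG
  have hstep : ∀ j, rogersL (q ^ (j + 1) * (1 - q) ^ 2 / (1 - q ^ (j + 2)) ^ 2) =
      G j - G (j + 1) := by
    intro j
    have := rogersL_five_term (hx j) (hy j)
    rw [hu, hv] at this
    rw [hxy]
    simp only [hG]
    linarith
  have hlim : Tendsto (fun j : ℕ => q ^ j) atTop (𝓝 0) :=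
    tendsto_pow_atTop_nhds_zero_of_lt_one hq0.le hq.2
  have hden : Tendsto (fun j : ℕ => 1 - q ^ (j + 2)) atTop (𝓝 1) := by
    simpa using ((tendsto_add_atTop_iff_nat 2).mpr hlim).const_sub 1
  have hxlim : Tendsto x atTop (𝓝 (1 - q)) := by
    simpa [Pi.div_def] using (tendsto_const_nhds (x := 1 - q)).div hden one_ne_zero
  have hylim : Tendsto y atTop (𝓝 0) := by
    simpa [Pi.div_def] using (((tendsto_add_atTop_iff_nat 1).mpr hlim).mul_const (1 - q)).div hden one_ne_zero
  have hL0 : Tendsto (fun j => rogersL (y j)) atTop (𝓝 0) := by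
    have h := continuousOn_rogersL 0 (left_mem_Ico.mpr one_pos)
    have h' := h.tendsto.comp (tendsto_nhdsWithin_iff.mpr
      ⟨hylim, Eventually.of_forall fun j => Ioo_subset_Ico_self (hy j)⟩)
    simpa [rogersL, Function.comp_def] using h'
  have hGlim : Tendsto G atTop (𝓝 (rogersL (1 - q))) := by
    simpa using ((continuousAt_rogersL ⟨hq1, by linarith⟩).tendsto.comp hxlim).add hL0
  have hG0 : G 0 = rogersL q + rogersL (1 - q) := by
    have h : y 0 = 1 - x 0 := by
      rw [hx1]
      simp only [hydef]
      ring
    simp only [hG]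
    rw [h]
    exact rogersL_add_rogersL_one_sub (hx 0) hq
  rw [hasSum_iff_tendsto_nat_of_nonneg]
  · simp_rw [hstep, Finset.sum_range_sub']
    simpa [hG0] using hGlim.const_sub (G 0)
  · intro j
    rw [hxy]
    exact rogersL_nonneg ⟨mul_pos (hx j).1 (hy j).1,
      by nlinarith [(hx j).1, (hx j).2, (hy j).1, (hy j).2]⟩

lemma coe_lucasNum (n : ℕ) :
    (lucasNum n : ℝ) = Real.goldenRatio ^ n + Real.goldenConj ^ n := by
  induction n using Nat.twoStepInduction with
  | zero => norm_num [lucasNum]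
  | one => simp [lucasNum]
  | more n h0 h1 =>
    have e : lucasNum (n + 2) = lucasNum (n + 1) + lucasNum n := by simp [lucasNum]
    rw [e]
    push_cast
    rw [h0, h1, pow_add _ n 2, pow_add _ n 2, Real.goldenRatio_sq, Real.goldenConj_sq]
    ring

lemma goldenConj_eq : Real.goldenConj = -(Real.goldenRatio)⁻¹ := by
  rw [Real.inv_goldenRatio, neg_neg]

lemma coe_lucasNum_of_odd {n : ℕ} (hn : Odd n) :
    (lucasNum n : ℝ) = Real.goldenRatio ^ n - (Real.goldenRatio ^ n)⁻¹ := by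
  rw [coe_lucasNum, goldenConj_eq, hn.neg_pow, inv_pow, sub_eq_add_neg]

lemma five_mul_fib_sq_of_even {n : ℕ} (hn : Even n) :
    5 * (Nat.fib n : ℝ) ^ 2 = (Real.goldenRatio ^ n - (Real.goldenRatio ^ n)⁻¹) ^ 2 := by
  rw [Real.coe_fib_eq, goldenConj_eq, hn.neg_pow, inv_pow, div_pow, Real.sq_sqrt (by norm_num)]
  ring

lemma sub_inv_sq_div_sub_inv_sq {t : ℝ} (ht : 1 < t) (j : ℕ) :
    (t - t⁻¹) ^ 2 / (t ^ (j + 2) - (t ^ (j + 2))⁻¹) ^ 2 =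
      (1 / t ^ 2) ^ (j + 1) * (1 - 1 / t ^ 2) ^ 2 / (1 - (1 / t ^ 2) ^ (j + 2)) ^ 2 := by
  have ht0 : t ≠ 0 := by positivity
  have h1 : t - t⁻¹ = t * (1 - 1 / t ^ 2) := by
    field_simp
  have h2 : t ^ (j + 2) - (t ^ (j + 2))⁻¹ = t ^ (j + 2) * (1 - (1 / t ^ 2) ^ (j + 2)) := by
    rw [mul_sub, mul_one, div_pow, one_pow, ← pow_mul, mul_comm 2, pow_mul]
    field_simp
  rw [h1, h2, mul_pow, mul_pow, mul_div_mul_comm, mul_div_assoc]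
  congr 1
  rw [div_pow, one_pow, ← pow_mul, ← pow_mul, div_eq_div_iff (by positivity) (by positivity),
    one_mul, ← pow_add]
  congr 1
  ring

lemma Summable.tsum_even_add_tsum_odd {f : ℕ → ℝ} (hf : Summable f) :
    ∑' n, f (2 * n) + ∑' n, f (2 * n + 1) = ∑' n, f n := by
  have hi : Function.Injective fun n : ℕ => 2 * n := mul_right_injective₀ two_ne_zero
  exact tsum_even_add_odd (hf.comp_injective hi)
    (hf.comp_injective ((add_left_injective 1).comp hi))

theorem stmt_16 (k : ℕ) (hk : 0 < k) (hkodd : Odd k) :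
    (∑' n : ℕ, rogersL ((lucasNum k : ℝ) ^ 2 / (5 * (Nat.fib (2 * k * (n + 1)) : ℝ) ^ 2))) +
      (∑' n : ℕ, rogersL ((lucasNum k : ℝ) ^ 2 / (lucasNum (k * (2 * (n + 1) + 1)) : ℝ) ^ 2)) =
      rogersL (1 / ((1 + Real.sqrt 5) / 2) ^ (2 * k)) := by
  set t : ℝ := Real.goldenRatio ^ k with ht
  have ht1 : 1 < t := one_lt_pow₀ Real.one_lt_goldenRatio hk.ne'
  have hq : 1 / t ^ 2 ∈ Ioo (0 : ℝ) 1 := by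
    have : 1 < t ^ 2 := one_lt_pow₀ ht1 two_ne_zero
    exact ⟨by positivity, (div_lt_one (by positivity)).mpr this⟩
  have hsum := hasSum_rogersL_qNumber hq
  simp_rw [← sub_inv_sq_div_sub_inv_sq ht1] at hsum
  have hrhs : 1 / ((1 + Real.sqrt 5) / 2) ^ (2 * k) = 1 / t ^ 2 := by
    rw [ht, ← pow_mul, mul_comm 2 k]
  have heven : ∀ n : ℕ, (lucasNum k : ℝ) ^ 2 / (5 * (Nat.fib (2 * k * (n + 1)) : ℝ) ^ 2) =
      (t - t⁻¹) ^ 2 / (t ^ (2 * n + 2) - (t ^ (2 * n + 2))⁻¹) ^ 2 := by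
    intro n
    rw [coe_lucasNum_of_odd hkodd, five_mul_fib_sq_of_even (by simp [mul_assoc]), ht, ← pow_mul,
      show k * (2 * n + 2) = 2 * k * (n + 1) by ring]
  have hodd : ∀ n : ℕ, (lucasNum k : ℝ) ^ 2 / (lucasNum (k * (2 * (n + 1) + 1)) : ℝ) ^ 2 =
      (t - t⁻¹) ^ 2 / (t ^ (2 * n + 1 + 2) - (t ^ (2 * n + 1 + 2))⁻¹) ^ 2 := by
    intro n
    rw [coe_lucasNum_of_odd hkodd, coe_lucasNum_of_odd (hkodd.mul (odd_two_mul_add_one _)), ht,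
      ← pow_mul, show k * (2 * n + 1 + 2) = k * (2 * (n + 1) + 1) by ring]
  simp_rw [heven, hodd, hrhs]
  rw [← hsum.tsum_eq]
  exact hsum.summable.tsum_even_add_tsum_odd
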